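/- Let G be a finite abelian group, M a subgroup of order m, and H = G/M. If f₁, …, f_t : G → ℂ are complementary functions with paf-constants α₀ and α, then the M-compressions f₁^M, …, f_t^M : H → ℂ are complementary functions with paf-constants α₀^M = α₀ + (m−1)α and α^M = m·α. -/

import Mathlib

open Finset

/-- The periodic autocorrelation function `paf_f(x) = ∑_{y∈G} f(xy)·conj(f(y))`. -/
noncomputable def paf {G : Type*} [Mul G] [Fintype G] (f : G → ℂ) (x : G) : ℂ :=
  ∑ y : G, f (x * y) * (starRingEnd ℂ) (f y)

/-- `f₁,…,f_t` are complementary with paf-constants `α₀, α`. -/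
def Complementary {G : Type*} [CommGroup G] [Fintype G] {t : ℕ} (f : Fin t → G → ℂ)
    (α₀ α : ℂ) : Prop :=
  (∑ i, paf (f i) (1 : G) = α₀) ∧ ∀ s : G, s ≠ 1 → ∑ i, paf (f i) s = α

lemma fiber_sum_eq {G : Type*} [CommGroup G] [Fintype G] (M : Subgroup G)
    [Fintype M] [DecidableEq (G ⧸ M)] (F : G → ℂ) (x : G) :
    ∑ y ∈ Finset.univ.filter (fun y : G => (y : G ⧸ M) = (x : G ⧸ M)), F y = ∑ z : M, F (x * z) := by
  symm
  refine Finset.sum_bij (fun (z : M) _ => x * (z : G)) ?_ ?_ ?_ ?_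
  · intro z _
    simp
  · intro a _ b _ hab
    exact Subtype.ext (mul_left_cancel hab)
  · intro y hy
    have hy' : (x : G ⧸ M) = y := ((Finset.mem_filter.mp hy).2).symm
    exact ⟨⟨x⁻¹ * y, QuotientGroup.eq.mp hy'⟩, Finset.mem_univ _, by simp⟩
  · intro z _
    rfl

lemma paf_compression {G : Type*} [CommGroup G] [Fintype G] (M : Subgroup G)
    [Fintype M] [Fintype (G ⧸ M)] (f : G → ℂ) (fM : G ⧸ M → ℂ)
    (hfM : ∀ x : G, fM (x : G ⧸ M) = ∑ z : M, f (x * z)) (x : G) :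
    paf fM (x : G ⧸ M) = ∑ z : M, paf f (x * z) := by
  classical
  have h1 : ∑ z : M, paf f (x * z)
      = ∑ y : G, fM ((x : G ⧸ M) * (y : G ⧸ M)) * (starRingEnd ℂ) (f y) := by
    unfold paf
    rw [Finset.sum_comm]
    refine Finset.sum_congr rfl fun y _ => ?_
    rw [← QuotientGroup.mk_mul, hfM, Finset.sum_mul]
    refine Finset.sum_congr rfl fun z _ => ?_
    rw [mul_right_comm]
  rw [h1, ← Finset.sum_fiberwise (s := Finset.univ) (g := fun y : G => (y : G ⧸ M))]
  unfold paf
  refine Finset.sum_congr rfl fun q _ => ?_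
  induction q using QuotientGroup.induction_on with
  | H w =>
    rw [hfM w, ← fiber_sum_eq M f w, map_sum, Finset.mul_sum]
    refine Finset.sum_congr rfl fun y hy => ?_
    rw [(Finset.mem_filter.mp hy).2]

/-- If `f₁,…,f_t : G → ℂ` are complementary with paf-constants `α₀, α`, then their
`M`-compressions `fᵢ^M(xM) = ∑_{z∈M} fᵢ(xz)` are complementary functions on `H = G/M`
with paf-constants `α₀^M = α₀ + (m−1)α` and `α^M = mα`, where `m = |M|`. -/
theorem compression_complementary {G : Type*} [CommGroup G] [Fintype G] (M : Subgroup G)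
    [Fintype M] [Fintype (G ⧸ M)] {t : ℕ} (f : Fin t → G → ℂ) (α₀ α : ℂ)
    (h : Complementary f α₀ α) (fM : Fin t → G ⧸ M → ℂ)
    (hfM : ∀ i (x : G), fM i (x : G ⧸ M) = ∑ z : M, f i (x * z)) :
    Complementary fM (α₀ + ((Fintype.card M : ℂ) - 1) * α) ((Fintype.card M : ℂ) * α) := by
  classical
  have key : ∀ x : G, ∑ i, paf (fM i) (x : G ⧸ M) = ∑ z : M, ∑ i, paf (f i) (x * z) := by
    intro x
    rw [Finset.sum_comm]
    exact Finset.sum_congr rfl fun i _ => paf_compression M (f i) (fM i) (hfM i) x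
  obtain ⟨h0, h1⟩ := h
  refine ⟨?_, ?_⟩
  · rw [← QuotientGroup.mk_one, key 1, ← Finset.add_sum_erase _ _ (Finset.mem_univ (1 : M))]
    congr 1
    · simpa using h0
    · rw [Finset.sum_congr rfl (g := fun _ => α)]
      · rw [Finset.sum_const, Finset.card_erase_of_mem (Finset.mem_univ _), Finset.card_univ,
          nsmul_eq_mul, Nat.cast_sub Fintype.card_pos, Nat.cast_one]
      · intro z hz
        refine h1 _ ?_
        have := (Finset.mem_erase.mp hz).1
        simpa using this
  · intro s hs
    induction s using QuotientGroup.induction_on with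
    | H x =>
      rw [key x, Finset.sum_congr rfl (g := fun _ => α)]
      · rw [Finset.sum_const, Finset.card_univ, nsmul_eq_mul]
      · intro z _
        refine h1 _ fun hxz => hs ?_
        rw [QuotientGroup.eq_one_iff, eq_inv_of_mul_eq_one_left hxz]
        exact M.inv_mem z.2
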